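/- Let a reversible Markov chain T act on the finite configuration space {m : V → ℕ | m_v ≤ z_v} of a graph with degrees z_v ≤ z_0, where transitions are compositions of allowed firing/anti-firing moves and T is symmetric. Then for every vertex v, the infinite-time average of the connected autocorrelation C_v(t) = E[m_v(t) m_v(0)] − E[m_v]², taken over the uniform (infinite-temperature) initial distribution, is bounded below by (z_v/2)² · (z_0+1)^{−2 z_0} > 0. -/

import Mathlib

open scoped Classical

variable {V : Type*}

/-- A firing move at vertex `v`. -/
def fireStep (G : SimpleGraph V) [DecidableRel G.Adj] [G.LocallyFinite]
    (v : V) (m m' : V → ℕ) : Prop :=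
  m v = G.degree v ∧ (∀ w, G.Adj v w → m w < G.degree w) ∧
    m' v = 0 ∧ (∀ w, G.Adj v w → m' w = m w + 1) ∧
    (∀ w, w ≠ v → ¬ G.Adj v w → m' w = m w)

/-- An anti-firing move at vertex `v`. -/
def antifireStep (G : SimpleGraph V) [DecidableRel G.Adj] [G.LocallyFinite]
    (v : V) (m m' : V → ℕ) : Prop :=
  m v = 0 ∧ (∀ w, G.Adj v w → 1 ≤ m w) ∧
    m' v = G.degree v ∧ (∀ w, G.Adj v w → m' w + 1 = m w) ∧
    (∀ w, w ≠ v → ¬ G.Adj v w → m' w = m w)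

/-- A single allowed move. -/
def moveStep (G : SimpleGraph V) [DecidableRel G.Adj] [G.LocallyFinite]
    (m m' : V → ℕ) : Prop :=
  ∃ v, fireStep G v m m' ∨ antifireStep G v m m'


/-- `m` arises from a base height `β` by the net moves `d x y` that each neighbour `y` has made
since the last move of `x`; the remaining fields record how these counters alternate. -/
structure MoveRecord (G : SimpleGraph V) [G.LocallyFinite]
    (m : V → ℕ) (β : V → ℤ) (d : V → V → ℤ) : Prop where
  height_eq : ∀ x, (m x : ℤ) = β x + ∑ y ∈ G.neighborFinset x, d x y
  le_one : ∀ x y, G.Adj x y → d x y ≤ 1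
  neg_one_le : ∀ x y, G.Adj x y → -1 ≤ d x y
  of_eq_one : ∀ x y, G.Adj x y → d x y = 1 → β y = 0 ∧ d y x = 0
  of_eq_neg_one : ∀ x y, G.Adj x y → d x y = -1 → β y = G.degree y ∧ d y x = 0

section Moves

variable {G : SimpleGraph V} [G.LocallyFinite]
  {m m' : V → ℕ} {β : V → ℤ} {d : V → V → ℤ} {w : V}

lemma sum_lt_degree {f : V → ℤ} {x y : V} (hf : ∀ y, G.Adj x y → f y ≤ 1) (hxy : G.Adj x y)
    (hy : f y ≤ 0) : ∑ y ∈ G.neighborFinset x, f y < G.degree x := by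
  have : ∑ y ∈ G.neighborFinset x, f y < ∑ y ∈ G.neighborFinset x, (1 : ℤ) :=
    Finset.sum_lt_sum (fun i hi => hf i (by simpa using hi)) ⟨y, by simpa using hxy, by omega⟩
  simpa using this

/-- A vertex at its initial or just-fired height cannot reach its degree while one of its
neighbours is inactive. -/
lemma MoveRecord.lt_degree (h : MoveRecord G m β d) {x y : V} (hβ : β x = 0) (hxy : G.Adj x y)
    (hd : d x y = 0) : m x < G.degree x := by
  have := sum_lt_degree (h.le_one x) hxy hd.le
  have := h.height_eq x
  omega

lemma MoveRecord.pos_of_neighbor_inactive (h : MoveRecord G m β d) {x y : V}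
    (hβ : β x = G.degree x) (hxy : G.Adj x y) (hd : d x y = 0) : 0 < m x := by
  have := sum_lt_degree (f := fun y => -d x y)
    (fun y hy => by have := h.neg_one_le x y hy; omega) hxy (by simp [hd])
  have := h.height_eq x
  rw [Finset.sum_neg_distrib] at *
  omega

/-- The counters after a net move `s` at `w`. -/
noncomputable def updateCounters (w : V) (s : ℤ) (d : V → V → ℤ) (x y : V) : ℤ :=
  if x = w then 0 else if y = w then d x y + s else d x y

lemma MoveRecord.height_update (h : MoveRecord G m β d) {s : ℤ}
    (hadj : ∀ y, G.Adj w y → (m' y : ℤ) = m y + s)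
    (hother : ∀ y, y ≠ w → ¬ G.Adj w y → m' y = m y) (x : V) :
    (m' x : ℤ) = Function.update β w (m' w) x +
      ∑ y ∈ G.neighborFinset x, updateCounters w s d x y := by
  rcases eq_or_ne x w with rfl | hx
  · simp [updateCounters]
  have hsum : ∑ y ∈ G.neighborFinset x, updateCounters w s d x y =
      ∑ y ∈ G.neighborFinset x, d x y + if G.Adj x w then s else 0 := by
    have : ∀ y, updateCounters w s d x y = d x y + if y = w then s else 0 := by
      intro y; simp only [updateCounters, if_neg hx]; split_ifs <;> simp
    simp [this, Finset.sum_add_distrib]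
  rw [hsum, Function.update_of_ne hx]
  have := h.height_eq x
  by_cases hxw : G.Adj x w
  · rw [if_pos hxw, hadj x hxw.symm]; omega
  · rw [if_neg hxw, hother x hx (fun h => hxw h.symm)]; omega

/-- `m` has a move record in which no vertex adjacent to `u` or `v` has ever moved. -/
def IsFrozenAround (G : SimpleGraph V) [G.LocallyFinite]
    (u v : V) (m : V → ℕ) : Prop :=
  ∃ β d, MoveRecord G m β d ∧
    ∀ y, G.Adj u y ∨ G.Adj v y → β y = 0 ∧ ∀ x, d x y = 0

lemma isFrozenAround_of_eq_zero {u v : V} (hm : ∀ y, G.Adj u y ∨ G.Adj v y → m y = 0) :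
    IsFrozenAround G u v m :=
  ⟨fun x => m x, fun _ _ => 0, by constructor <;> simp, by simpa using hm⟩

lemma IsFrozenAround.symm {u v : V} (h : IsFrozenAround G u v m) : IsFrozenAround G v u m := by
  simpa only [IsFrozenAround, or_comm] using h

lemma IsFrozenAround.eq_zero {u v : V} (huv : G.Adj u v) (h : IsFrozenAround G u v m) :
    m v = 0 := by
  obtain ⟨β, d, h, hA⟩ := h
  have := h.height_eq v
  rw [(hA v (.inl huv)).1, Finset.sum_eq_zero fun y hy => (hA y (.inr (by simpa using hy))).2 v]
    at this
  omega

variable [DecidableRel G.Adj]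

lemma MoveRecord.fire (h : MoveRecord G m β d) (hw : fireStep G w m m') :
    MoveRecord G m' (Function.update β w 0) (updateCounters w 1 d) := by
  obtain ⟨hm, -, hm', hadj, hother⟩ := hw
  have key : ∀ x, G.Adj x w → d x w ≠ 1 := fun x hx hd => by
    obtain ⟨hβ, hd'⟩ := h.of_eq_one x w hx hd
    exact (h.lt_degree hβ hx.symm hd').ne hm
  refine ⟨fun x => ?_, ?_, ?_, ?_, ?_⟩
  · simpa [hm'] using h.height_update (fun y hy => by simp [hadj y hy]) hother x
  all_goals
    intro x y hxy
    have := hxy.ne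
    have := h.le_one x y hxy
    have := h.neg_one_le x y hxy
    have := h.of_eq_one x y hxy
    have := h.of_eq_neg_one x y hxy
    have := key x
    simp only [updateCounters, Function.update_apply]
    grind

lemma MoveRecord.antifire (h : MoveRecord G m β d) (hw : antifireStep G w m m') :
    MoveRecord G m' (Function.update β w (G.degree w)) (updateCounters w (-1) d) := by
  obtain ⟨hm, -, hm', hadj, hother⟩ := hw
  have key : ∀ x, G.Adj x w → d x w ≠ -1 := fun x hx hd => by
    obtain ⟨hβ, hd'⟩ := h.of_eq_neg_one x w hx hd
    exact (h.pos_of_neighbor_inactive hβ hx.symm hd').ne' hm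
  refine ⟨fun x => ?_, ?_, ?_, ?_, ?_⟩
  · simpa [hm'] using h.height_update (fun y hy => by rw [← hadj y hy]; push_cast; ring) hother x
  all_goals
    intro x y hxy
    have := hxy.ne
    have := h.le_one x y hxy
    have := h.neg_one_le x y hxy
    have := h.of_eq_one x y hxy
    have := h.of_eq_neg_one x y hxy
    have := key x
    simp only [updateCounters, Function.update_apply]
    grind

lemma IsFrozenAround.step {u v : V} (huv : G.Adj u v) (h : IsFrozenAround G u v m)
    (hstep : moveStep G m m') : IsFrozenAround G u v m' := by
  have hu := h.symm.eq_zero huv.symm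
  have hv := h.eq_zero huv
  obtain ⟨β, d, h, hA⟩ := h
  obtain ⟨w, hw | hw⟩ := hstep
  · have hwA : ¬ (G.Adj u w ∨ G.Adj v w) := fun hwA => by
      have : m w < G.degree w := by
        rcases hwA with hc | hc
        · exact h.lt_degree (hA w (.inl hc)).1 hc.symm ((hA u (.inr huv.symm)).2 w)
        · exact h.lt_degree (hA w (.inr hc)).1 hc.symm ((hA v (.inl huv)).2 w)
      exact this.ne hw.1
    refine ⟨_, _, h.fire hw, fun y hy => ?_⟩
    have hyw : y ≠ w := by rintro rfl; exact hwA hy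
    simp [updateCounters, hyw, hA y hy]
  · have hwA : ¬ (G.Adj u w ∨ G.Adj v w) := fun hwA => by
      rcases hwA with hc | hc
      · have := hw.2.1 u hc.symm; omega
      · have := hw.2.1 v hc.symm; omega
    refine ⟨_, _, h.antifire hw, fun y hy => ?_⟩
    have hyw : y ≠ w := by rintro rfl; exact hwA hy
    simp [updateCounters, hyw, hA y hy]

/-- A vertex stays empty if all neighbours of the two ends of one of its edges start empty. -/
lemma eq_zero_of_reachable {u v : V} (huv : G.Adj u v)
    (hm : ∀ y, G.Adj u y ∨ G.Adj v y → m y = 0)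
    (hreach : Relation.ReflTransGen (moveStep G) m m') : m' v = 0 := by
  refine IsFrozenAround.eq_zero huv ?_
  induction hreach with
  | refl => exact isFrozenAround_of_eq_zero hm
  | tail _ hstep ih => exact ih.step huv hstep

end Moves

section Ergodic

variable {Ω : Type*} [Fintype Ω] {T : Matrix Ω Ω ℝ}

lemma norm_toEuclideanCLM_le_one [DecidableEq Ω] (hnonneg : ∀ a b, 0 ≤ T a b)
    (hrow : ∀ a, ∑ b, T a b = 1) (hcol : ∀ b, ∑ a, T a b = 1) :
    ‖Matrix.toEuclideanCLM (𝕜 := ℝ) T‖ ≤ 1 := by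
  refine ContinuousLinearMap.opNorm_le_bound _ zero_le_one fun x => ?_
  rw [one_mul, ← sq_le_sq₀ (norm_nonneg _) (norm_nonneg _), EuclideanSpace.real_norm_sq_eq,
    EuclideanSpace.real_norm_sq_eq]
  calc ∑ a, (∑ b, T a b * x b) ^ 2 ≤ ∑ a, ∑ b, T a b * x b ^ 2 :=
        Finset.sum_le_sum fun a _ => Real.pow_arith_mean_le_arith_mean_pow_of_even _ _ _
          (fun b _ => hnonneg a b) (hrow a) even_two
    _ = ∑ b, x b ^ 2 := by
        rw [Finset.sum_comm]
        simp [← Finset.sum_mul, hcol]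

/-- The mean ergodic theorem for a symmetric stochastic matrix on a finite space: the limit `g`
of the time averages of `f` has the same sum as `f` and is the orthogonal projection of `f`. -/
lemma exists_tendsto_time_average [DecidableEq Ω] (hsymm : ∀ a b, T a b = T b a)
    (hnonneg : ∀ a b, 0 ≤ T a b) (hstoch : ∀ a, ∑ b, T a b = 1) (f : Ω → ℝ) :
    ∃ g : Ω → ℝ,
      (∀ b, Filter.Tendsto
        (fun n : ℕ => (1 / (n : ℝ)) * ∑ t ∈ Finset.range n, ∑ a, (T ^ t) b a * f a)
        Filter.atTop (nhds (g b))) ∧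
      ∑ b, g b = ∑ b, f b ∧ ∑ b, f b * g b = ∑ b, g b ^ 2 := by
  set A := Matrix.toEuclideanCLM (𝕜 := ℝ) T with hA
  set K := A.toLinearMap.eqLocus
    (1 : EuclideanSpace ℝ Ω →L[ℝ] EuclideanSpace ℝ Ω).toLinearMap
  set F : EuclideanSpace ℝ Ω := WithLp.toLp 2 f with hF
  have hlim := A.tendsto_birkhoffAverage_orthogonalProjection
    (norm_toEuclideanCLM_le_one hnonneg hstoch fun b => by simpa only [hsymm _ b] using hstoch b) F
  have hiter : ∀ t : ℕ, (A^[t] F) = WithLp.toLp 2 ((T ^ t).mulVec f) := fun t => by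
    rw [← FunLike.coe_pow_eq_iterate, hA, ← map_pow, hF, Matrix.toEuclideanCLM_toLp]
  refine ⟨K.starProjection F, fun b => ?_, ?_, ?_⟩
  · have := ((EuclideanSpace.proj (𝕜 := ℝ) b).continuous.tendsto _).comp hlim
    refine this.congr fun n => ?_
    simp [birkhoffAverage, birkhoffSum, hiter, Matrix.mulVec, dotProduct]
  · have h1 : (WithLp.toLp 2 1 : EuclideanSpace ℝ Ω) ∈ K := by
      change A (WithLp.toLp 2 1) = WithLp.toLp 2 1
      rw [hA, Matrix.toEuclideanCLM_toLp]
      congr 1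
      ext a
      simp [Matrix.mulVec, dotProduct, hstoch]
    have := K.inner_starProjection_left_eq_right F (WithLp.toLp 2 1)
    rw [Submodule.starProjection_eq_self_iff.mpr h1] at this
    simpa [PiLp.inner_apply, hF] using this
  · have := K.inner_starProjection_left_eq_right F (K.starProjection F)
    rw [Submodule.starProjection_eq_self_iff.mpr (K.starProjection_apply_mem F)] at this
    simpa [-inner_self_eq_norm_sq_to_K, PiLp.inner_apply, hF, sq, mul_comm] using this.symm

end Ergodic

section Configurations

variable {G : SimpleGraph V} [Fintype V] [DecidableRel G.Adj]

lemma mean_height [DecidableEq V] (v : V) :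
    (1 / (Fintype.card (∀ w : V, Fin (G.degree w + 1)) : ℝ)) *
      ∑ b : (∀ w : V, Fin (G.degree w + 1)), ((b v : ℕ) : ℝ) = (G.degree v : ℝ) / 2 := by
  have hrev : ∑ b : (∀ w : V, Fin (G.degree w + 1)), ((b v : ℕ) : ℝ) =
      ∑ b : (∀ w : V, Fin (G.degree w + 1)), ((G.degree v : ℝ) - ((b v : ℕ) : ℝ)) := by
    refine Fintype.sum_equiv (Equiv.piCongrRight fun w => Fin.revPerm) _ _ fun b => ?_
    have := (b v).is_le
    simp [Fin.val_rev, Nat.cast_sub this]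
  have hcard : (Fintype.card (∀ w : V, Fin (G.degree w + 1)) : ℝ) ≠ 0 := by
    exact_mod_cast Fintype.card_ne_zero
  rw [Finset.sum_sub_distrib, Finset.sum_const, Finset.card_univ, nsmul_eq_mul] at hrev
  field_simp
  linarith

/-- The configurations vanishing on `A` make up at least a fraction `(z₀+1)^(-|A|)` of all. -/
lemma card_le_pow_mul_card_vanishing [DecidableEq V] {z0 : ℕ} (hz0 : ∀ w, G.degree w ≤ z0)
    (A : Finset V) :
    Fintype.card (∀ w : V, Fin (G.degree w + 1)) ≤ (z0 + 1) ^ A.card *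
      (Fintype.piFinset fun w : V =>
        if w ∈ A then ({0} : Finset (Fin (G.degree w + 1))) else Finset.univ).card := by
  have hcard : ∀ w, (if w ∈ A then ({0} : Finset (Fin (G.degree w + 1)))
      else Finset.univ).card = if w ∈ A then 1 else G.degree w + 1 := fun w => by
    split_ifs <;> simp
  have hpow : (z0 + 1) ^ A.card = ∏ w : V, if w ∈ A then z0 + 1 else 1 := by
    simp [Finset.prod_ite_mem]
  rw [Fintype.card_pi, Fintype.card_piFinset, hpow, ← Finset.prod_mul_distrib]
  refine Finset.prod_le_prod' fun w _ => ?_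
  rw [hcard w]
  have := hz0 w
  split_ifs <;> simp [this]

lemma reachable_of_pow_apply_ne_zero [DecidableEq V]
    {T : Matrix (∀ w : V, Fin (G.degree w + 1)) (∀ w : V, Fin (G.degree w + 1)) ℝ}
    (hsupp : ∀ a b, T a b ≠ 0 →
      Relation.ReflTransGen (moveStep G) (fun w => (a w : ℕ)) (fun w => (b w : ℕ)))
    (t : ℕ) (a b : ∀ w : V, Fin (G.degree w + 1)) (hab : (T ^ t) a b ≠ 0) :
    Relation.ReflTransGen (moveStep G) (fun w => (a w : ℕ)) (fun w => (b w : ℕ)) := by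
  induction t generalizing b with
  | zero =>
    obtain rfl : a = b := by
      by_contra h
      exact hab (by simp [h])
    exact .refl
  | succ t ih =>
    rw [pow_succ, Matrix.mul_apply] at hab
    obtain ⟨c, -, hc⟩ := Finset.exists_ne_zero_of_sum_ne_zero hab
    exact (ih c (left_ne_zero_of_mul hc)).trans (hsupp c b (right_ne_zero_of_mul hc))

end Configurations

/-- For a reversible (symmetric) Markov chain on the configuration space
`{m : V → ℕ | m v ≤ deg v}` of a graph with degrees bounded by `z₀`, whose transitions are
compositions of allowed firing/anti-firing moves, the infinite-time (Cesàro) average of the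
connected autocorrelation of `m_v` at infinite temperature exists and is bounded below by
`(z_v/2)² (z₀+1)^(−2 z₀) > 0`. -/
theorem localization_lower_bound (G : SimpleGraph V) [Fintype V] [DecidableEq V]
    [DecidableRel G.Adj]
    (z0 : ℕ) (hz0 : ∀ w, G.degree w ≤ z0)
    (T : Matrix (∀ w : V, Fin (G.degree w + 1)) (∀ w : V, Fin (G.degree w + 1)) ℝ)
    (hsymm : ∀ a b, T a b = T b a)
    (hnonneg : ∀ a b, 0 ≤ T a b)
    (hstoch : ∀ a, ∑ b, T a b = 1)
    (hsupp : ∀ a b, T a b ≠ 0 →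
      Relation.ReflTransGen (moveStep G) (fun w => (a w : ℕ)) (fun w => (b w : ℕ)))
    (v : V) :
    ∃ ℓ : ℝ,
      Filter.Tendsto (fun τ : ℕ => (1 / (τ : ℝ)) * ∑ t ∈ Finset.range τ,
          ((1 / (Fintype.card (∀ w : V, Fin (G.degree w + 1)) : ℝ)) *
              ∑ b : (∀ w : V, Fin (G.degree w + 1)), ((b v : ℕ) : ℝ) * ∑ a : (∀ w : V, Fin (G.degree w + 1)), (T ^ t) a b * ((a v : ℕ) : ℝ) -
            ((1 / (Fintype.card (∀ w : V, Fin (G.degree w + 1)) : ℝ)) *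
              ∑ b : (∀ w : V, Fin (G.degree w + 1)), ((b v : ℕ) : ℝ)) ^ 2))
        Filter.atTop (nhds ℓ) ∧
      ((G.degree v : ℝ) / 2) ^ 2 / ((z0 : ℝ) + 1) ^ (2 * z0) ≤ ℓ := by
  obtain ⟨g, hg, hsum, hsq⟩ := exists_tendsto_time_average hsymm hnonneg hstoch
    fun b => ((b v : ℕ) : ℝ)
  have hmean := mean_height (G := G) v
  set D : ℝ := (Fintype.card (∀ w : V, Fin (G.degree w + 1)) : ℝ) with hD
  set μ : ℝ := (G.degree v : ℝ) / 2 with hμ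
  have hDpos : 0 < D := by
    rw [hD]
    exact_mod_cast Fintype.card_pos
  have hTsymm : ∀ (t : ℕ) a b, (T ^ t) a b = (T ^ t) b a := fun t a b => by
    have hT : T.transpose = T := Matrix.ext fun a b => hsymm b a
    rw [← Matrix.transpose_apply (T ^ t), Matrix.transpose_pow, hT]
  refine ⟨(1 / D) * ∑ b, ((b v : ℕ) : ℝ) * g b - μ ^ 2, ?_, ?_⟩
  · have hlim := ((tendsto_finsetSum Finset.univ fun b _ =>
      (hg b).const_mul ((b v : ℕ) : ℝ)).const_mul (1 / D)).sub_const (μ ^ 2)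
    refine hlim.congr' ?_
    filter_upwards [Filter.eventually_gt_atTop 0] with n hn
    have hn' : (n : ℝ) ≠ 0 := by positivity
    simp only [hmean, Finset.sum_sub_distrib, Finset.sum_const, Finset.card_range, nsmul_eq_mul,
      mul_sub, ← Finset.mul_sum]
    congr 1
    · simp only [Finset.mul_sum]
      rw [Finset.sum_comm]
      refine Finset.sum_congr rfl fun t _ => Finset.sum_congr rfl fun b _ =>
        Finset.sum_congr rfl fun a _ => ?_
      rw [hTsymm t a b]
      ring
    · field_simp
  · have hvar : (1 / D) * ∑ b, ((b v : ℕ) : ℝ) * g b - μ ^ 2 = (1 / D) * ∑ b, (g b - μ) ^ 2 := by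
      have hμD : ∑ b, g b = μ * D := by
        rw [hsum, ← hmean]
        field_simp
      simp only [hsq, sub_sq, Finset.sum_add_distrib, Finset.sum_sub_distrib, ← Finset.sum_mul,
        ← Finset.mul_sum, hμD, Finset.sum_const, Finset.card_univ, nsmul_eq_mul, ← hD]
      field_simp
      ring
    rw [hvar]
    by_cases hv : ∃ u, G.Adj u v
    · obtain ⟨u, huv⟩ := hv
      set A := G.neighborFinset u ∪ G.neighborFinset v with hA
      set S := Fintype.piFinset fun w : V =>
        if w ∈ A then ({0} : Finset (Fin (G.degree w + 1))) else Finset.univ with hS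
      have hAcard : A.card ≤ 2 * z0 := by
        have hunion := Finset.card_union_le (G.neighborFinset u) (G.neighborFinset v)
        have := hz0 u
        have := hz0 v
        rw [← hA, G.card_neighborFinset_eq_degree, G.card_neighborFinset_eq_degree] at hunion
        omega
      have hcard : D ≤ ((z0 : ℝ) + 1) ^ (2 * z0) * S.card := by
        have := (card_le_pow_mul_card_vanishing hz0 A).trans
          (Nat.mul_le_mul_right _ (Nat.pow_le_pow_right z0.succ_pos hAcard))
        rw [hD]
        exact_mod_cast this
      have hgS : ∀ b ∈ S, g b = 0 := fun b hb => by
        refine tendsto_nhds_unique (hg b) (tendsto_const_nhds.congr fun n => ?_)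
        symm
        refine mul_eq_zero_of_right _ (Finset.sum_eq_zero fun t _ =>
          Finset.sum_eq_zero fun a _ => ?_)
        by_contra hne
        refine right_ne_zero_of_mul hne ?_
        have := eq_zero_of_reachable huv (fun y hy => ?_)
          (reachable_of_pow_apply_ne_zero hsupp t b a (left_ne_zero_of_mul hne))
        · exact_mod_cast this
        · have hyA : y ∈ A := by simpa [hA] using hy
          have := Fintype.mem_piFinset.mp hb y
          rw [if_pos hyA, Finset.mem_singleton] at this
          simp [this]
      have hle : S.card * μ ^ 2 ≤ ∑ b, (g b - μ) ^ 2 := by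
        calc (S.card : ℝ) * μ ^ 2 = ∑ b ∈ S, (g b - μ) ^ 2 := by
              rw [Finset.sum_congr rfl fun b hb => by rw [hgS b hb, zero_sub, neg_sq]]
              simp
          _ ≤ _ := Finset.sum_le_sum_of_subset_of_nonneg (Finset.subset_univ _)
              fun _ _ _ => sq_nonneg _
      rw [one_div_mul_eq_div, div_le_div_iff₀ (by positivity) hDpos]
      calc μ ^ 2 * D ≤ μ ^ 2 * (((z0 : ℝ) + 1) ^ (2 * z0) * S.card) := by gcongr
        _ = (S.card * μ ^ 2) * ((z0 : ℝ) + 1) ^ (2 * z0) := by ring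
        _ ≤ _ := by gcongr
    · have hdeg : G.degree v = 0 := by
        by_contra h
        obtain ⟨u, hu⟩ := (G.degree_pos_iff_exists_adj v).mp (Nat.pos_of_ne_zero h)
        exact hv ⟨u, hu.symm⟩
      rw [hμ, hdeg]
      simp only [Nat.cast_zero, zero_div, ne_eq, OfNat.ofNat_ne_zero, not_false_eq_true, zero_pow]
      positivity
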